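/- arXiv:math/0508476 — 3 statements merged into one kernel-verified Lean document; each statement's English description precedes it below -/
import Mathlib

section
/- Let B ⊆ L⁺ be a nonempty subset of the positive light cone that is discrete and radially dense, and let C be the closed convex hull of B in ℝ³. Then for every w ∈ ℝ³ with ⟨w,w⟩ < 0 and w₃ > 0 (i.e., every ray from the origin lying in the open interior of the light cone), the ray {t·w : t > 0} meets the topological frontier of C in exactly one point. -/
noncomputable section

/-- The Minkowski bilinear form on `ℝ³`: `⟨u,v⟩ = u₁v₁ + u₂v₂ − u₃v₃`. -/
def mink (u v : Fin 3 → ℝ) : ℝ := u 0 * v 0 + u 1 * v 1 - u 2 * v 2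

/-- The positive light cone `L⁺ = {w : ⟨w,w⟩ = 0, w₃ > 0}`. -/
def LPlus : Set (Fin 3 → ℝ) := {w | mink w w = 0 ∧ 0 < w 2}

/-- `B` is discrete: every compact subset of `ℝ³` contains only finitely many points of `B`. -/
def DiscreteIn (B : Set (Fin 3 → ℝ)) : Prop :=
  ∀ K : Set (Fin 3 → ℝ), IsCompact K → (B ∩ K).Finite

/-- `B ⊆ L⁺` is radially dense: `{z/z₃ : z ∈ B}` is dense in the unit circle
`{(cos θ, sin θ, 1)}`. -/
def RadiallyDense (B : Set (Fin 3 → ℝ)) : Prop :=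
  {p : Fin 3 → ℝ | ∃ θ : ℝ, p = ![Real.cos θ, Real.sin θ, 1]} ⊆
    closure {p : Fin 3 → ℝ | ∃ z ∈ B, p = (z 2)⁻¹ • z}

/-- The interior of the future light cone. -/
def futureCone : Set (Fin 3 → ℝ) := {w | mink w w < 0 ∧ 0 < w 2}

/-- The point of the unit circle at height one with angle `θ`. -/
def circlePoint (θ : ℝ) : Fin 3 → ℝ := ![Real.cos θ, Real.sin θ, 1]

theorem continuous_circlePoint : Continuous circlePoint := by
  refine continuous_pi fun i => ?_
  fin_cases i
  · exact Real.continuous_cos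
  · exact Real.continuous_sin
  · exact continuous_const

theorem isOpen_futureCone : IsOpen futureCone := by
  have h : Continuous fun w => mink w w := by
    unfold mink
    fun_prop
  exact (isOpen_lt h continuous_const).inter (isOpen_lt continuous_const (continuous_apply 2))

theorem smul_mem_futureCone {w : Fin 3 → ℝ} (hw : w ∈ futureCone) {s : ℝ} (hs : 0 < s) :
    s • w ∈ futureCone := by
  obtain ⟨h1, h2⟩ := hw
  refine ⟨?_, by simpa using mul_pos hs h2⟩
  have : mink (s • w) (s • w) = s ^ 2 * mink w w := by
    simp only [mink, Pi.smul_apply, smul_eq_mul]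
    ring
  rw [this]
  exact mul_neg_of_pos_of_neg (by positivity) h1

/-- A discrete subset of the light cone has finitely many points below any given height. -/
theorem DiscreteIn.finite_height_le {B : Set (Fin 3 → ℝ)} (hdisc : DiscreteIn B)
    (hBL : B ⊆ LPlus) (R : ℝ) : (B ∩ {z | z 2 ≤ R}).Finite := by
  refine (hdisc (Set.Icc (fun _ => -R) (fun _ => R)) isCompact_Icc).subset ?_
  rintro z ⟨hz, hR : z 2 ≤ R⟩
  obtain ⟨h1, h2⟩ := hBL hz
  unfold mink at h1
  have ha : |z 0| ≤ R := (abs_le_of_sq_le_sq (by nlinarith [sq_nonneg (z 1)]) h2.le).trans hR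
  have hb : |z 1| ≤ R := (abs_le_of_sq_le_sq (by nlinarith [sq_nonneg (z 0)]) h2.le).trans hR
  rw [abs_le] at ha hb
  refine ⟨hz, fun i => ?_, fun i => ?_⟩
  · fin_cases i
    · exact ha.1
    · exact hb.1
    · show -R ≤ z 2
      linarith
  · fin_cases i
    · exact ha.2
    · exact hb.2
    · exact hR

/-- A linear functional that is positive somewhere in the open cone is positive somewhere on the
circle. -/
theorem exists_circlePoint_pos {w : Fin 3 → ℝ} (hw : w ∈ futureCone)
    (f : (Fin 3 → ℝ) →L[ℝ] ℝ) (hf : 0 < f w) : ∃ θ, 0 < f (circlePoint θ) := by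
  obtain ⟨h1, h2⟩ := hw
  set c : ℂ := ⟨w 0, w 1⟩
  set φ := c.arg
  set r := ‖c‖
  have hx : r * Real.cos φ = w 0 := Complex.norm_mul_cos_arg c
  have hy : r * Real.sin φ = w 1 := Complex.norm_mul_sin_arg c
  have hr : r < w 2 := by
    refine lt_of_pow_lt_pow_left₀ 2 h2.le ?_
    unfold mink at h1
    rw [← hx, ← hy] at h1
    nlinarith [Real.sin_sq_add_cos_sq φ]
  have hr0 : 0 ≤ r := norm_nonneg c
  have hdecomp : w = ((w 2 + r) / 2) • circlePoint φ +
      ((w 2 - r) / 2) • circlePoint (φ + Real.pi) := by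
    ext i
    fin_cases i
    · simp [circlePoint, ← hx]
      ring
    · simp [circlePoint, ← hy]
      ring
    · simp [circlePoint]
      ring
  by_contra! hneg
  rw [hdecomp, map_add, map_smul, map_smul, smul_eq_mul, smul_eq_mul] at hf
  have e1 := mul_nonneg (by linarith : 0 ≤ (w 2 + r) / 2) (neg_nonneg.2 (hneg φ))
  have e2 := mul_nonneg (by linarith : 0 ≤ (w 2 - r) / 2) (neg_nonneg.2 (hneg (φ + Real.pi)))
  linarith

/-- A nonempty open set of angles gives infinitely many points of the circle. -/
theorem infinite_image_circlePoint {A : Set ℝ} (hA : IsOpen A) (hne : A.Nonempty) :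
    (circlePoint '' A).Infinite := by
  obtain ⟨θ, hθ⟩ := hne
  obtain ⟨ε, hε, hball⟩ := Metric.isOpen_iff.1 hA θ hθ
  set δ := min ε 1
  have hδ : 0 < δ := lt_min hε one_pos
  have hsub : Set.Ioo (θ - δ) (θ + δ) ⊆ A := by
    rw [← Real.ball_eq_Ioo]
    exact (Metric.ball_subset_ball (min_le_left _ _)).trans hball
  have hinj : Set.InjOn circlePoint (Set.Ioo (θ - δ) (θ + δ)) := by
    intro a ha b hb hab
    have hδ1 : δ ≤ 1 := min_le_right _ _
    have hc : Real.cos a = Real.cos b := congrFun hab 0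
    have hs : Real.sin a = Real.sin b := congrFun hab 1
    have hcos : Real.cos (a - b) = 1 := by
      rw [Real.cos_sub, hc, hs]
      nlinarith [Real.sin_sq_add_cos_sq b]
    have hpi := Real.pi_gt_three
    obtain ⟨ha1, ha2⟩ := ha
    obtain ⟨hb1, hb2⟩ := hb
    have := (Real.cos_eq_one_iff_of_lt_of_lt (by linarith) (by linarith)).1 hcos
    linarith
  exact ((Set.Ioo_infinite (by linarith)).image hinj).mono (Set.image_mono hsub)

/-- A linear functional bounded above on a discrete radially dense subset of the light cone is
nonpositive on the circle. -/
theorem circlePoint_nonpos_of_bddAbove {B : Set (Fin 3 → ℝ)} (hBL : B ⊆ LPlus)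
    (hdisc : DiscreteIn B) (hdense : RadiallyDense B) (f : (Fin 3 → ℝ) →L[ℝ] ℝ) {u : ℝ}
    (hu : ∀ z ∈ B, f z ≤ u) (θ : ℝ) : f (circlePoint θ) ≤ 0 := by
  by_contra! hpos
  obtain ⟨δ, hδ, hδθ⟩ := exists_between hpos
  set F : Set (Fin 3 → ℝ) := (fun z => (z 2)⁻¹ • z) '' (B ∩ {z | z 2 ≤ u / δ})
  have hF : F.Finite := (hdisc.finite_height_le hBL _).image _
  have hopen : IsOpen {p : Fin 3 → ℝ | δ < f p} := isOpen_lt continuous_const f.continuous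
  refine infinite_image_circlePoint (hopen.preimage continuous_circlePoint) ⟨θ, hδθ⟩
    (hF.subset ?_)
  rintro _ ⟨φ, hφ : δ < f (circlePoint φ), rfl⟩
  rw [← hF.isClosed.closure_eq]
  refine closure_mono ?_ (hopen.inter_closure ⟨hφ, hdense ⟨φ, rfl⟩⟩)
  rintro _ ⟨hp : δ < f _, z, hz, rfl⟩
  have hz2 := (hBL hz).2
  refine ⟨z, ⟨hz, ?_⟩, rfl⟩
  rw [map_smul, smul_eq_mul, inv_mul_eq_div, lt_div_iff₀ hz2] at hp
  rw [Set.mem_ofPred_eq, le_div_iff₀ hδ]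
  linarith [hu z hz]

/-- The open future cone consists of recession directions of the closed convex hull. -/
theorem add_mem_closure_convexHull {B : Set (Fin 3 → ℝ)} (hBL : B ⊆ LPlus)
    (hdisc : DiscreteIn B) (hdense : RadiallyDense B) {x w : Fin 3 → ℝ}
    (hx : x ∈ closure (convexHull ℝ B)) (hw : w ∈ futureCone) :
    x + w ∈ closure (convexHull ℝ B) := by
  by_contra hxw
  obtain ⟨f, u, hfu, hux⟩ := geometric_hahn_banach_closed_point
    (convex_convexHull ℝ B).closure isClosed_closure hxw
  rw [map_add] at hux
  obtain ⟨θ, hθ⟩ := exists_circlePoint_pos hw f (by linarith [hfu x hx])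
  exact hθ.not_ge (circlePoint_nonpos_of_bddAbove hBL hdisc hdense f
    (fun z hz => (hfu z (subset_closure (subset_convexHull ℝ B hz))).le) θ)

theorem add_mem_interior_closure_convexHull {B : Set (Fin 3 → ℝ)} (hBL : B ⊆ LPlus)
    (hdisc : DiscreteIn B) (hdense : RadiallyDense B) {x w : Fin 3 → ℝ}
    (hx : x ∈ closure (convexHull ℝ B)) (hw : w ∈ futureCone) :
    x + w ∈ interior (closure (convexHull ℝ B)) := by
  refine mem_interior.2 ⟨(fun y => y - x) ⁻¹' futureCone, fun y hy => ?_,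
    isOpen_futureCone.preimage (by fun_prop), by simpa using hw⟩
  simpa using add_mem_closure_convexHull hBL hdisc hdense hx hy

theorem exists_smul_sub_mem_futureCone {w : Fin 3 → ℝ} (hw : w ∈ futureCone)
    (z : Fin 3 → ℝ) : ∃ t : ℝ, t • w - z ∈ futureCone := by
  have hcont : ContinuousAt (fun s : ℝ => w - s • z) 0 := by fun_prop
  have hev : ∀ᶠ s : ℝ in nhds 0, w - s • z ∈ futureCone :=
    hcont.eventually_mem (isOpen_futureCone.mem_nhds (by simpa using hw))
  obtain ⟨s, hs, hs0⟩ := ((hev.filter_mono nhdsWithin_le_nhds).and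
    (self_mem_nhdsWithin : Set.Ioi (0 : ℝ) ∈ nhdsWithin 0 (Set.Ioi 0))).exists
  have hs0 : 0 < s := hs0
  refine ⟨s⁻¹, ?_⟩
  have := smul_mem_futureCone hs (inv_pos.2 hs0)
  rwa [smul_sub, smul_smul, inv_mul_cancel₀ hs0.ne', one_smul] at this

/-- The closed convex hull of a discrete subset of the light cone lies strictly above the
origin. -/
theorem exists_pos_le_height {B : Set (Fin 3 → ℝ)} (hne : B.Nonempty) (hBL : B ⊆ LPlus)
    (hdisc : DiscreteIn B) :
    ∃ m : ℝ, 0 < m ∧ ∀ x ∈ closure (convexHull ℝ B), m ≤ x 2 := by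
  obtain ⟨z₀, hz₀⟩ := hne
  obtain ⟨z, ⟨hz, hzle : z 2 ≤ z₀ 2⟩, hmin⟩ := Set.exists_min_image _ (fun z => z 2)
    (hdisc.finite_height_le hBL (z₀ 2)) ⟨z₀, hz₀, le_refl (z₀ 2)⟩
  refine ⟨z 2, (hBL hz).2, closure_minimal (convexHull_min (fun y hy => ?_) ?_) ?_⟩
  · rcases le_total (y 2) (z₀ 2) with h | h
    · exact hmin y ⟨hy, h⟩
    · exact hzle.trans h
  · exact convex_halfSpace_ge (LinearMap.proj (R := ℝ) (φ := fun _ : Fin 3 => ℝ) 2).isLinear _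
  · exact isClosed_le continuous_const (continuous_apply 2)

/-- For a nonempty, discrete, radially dense subset `B` of the positive light cone with closed
convex hull `C`, every ray from the origin lying in the open interior of the light cone meets
the topological frontier of `C` in exactly one point. -/
theorem ray_meets_frontier_convexHull_once (B : Set (Fin 3 → ℝ)) (hne : B.Nonempty)
    (hBL : B ⊆ LPlus) (hdisc : DiscreteIn B) (hdense : RadiallyDense B)
    (w : Fin 3 → ℝ) (hw : mink w w < 0) (hw2 : 0 < w 2) :
    ∃! x : Fin 3 → ℝ,
      (∃ t : ℝ, 0 < t ∧ x = t • w) ∧ x ∈ frontier (closure (convexHull ℝ B)) := by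
  have hwc : w ∈ futureCone := ⟨hw, hw2⟩
  set C := closure (convexHull ℝ B) with hC
  have hCc : IsClosed C := isClosed_closure
  obtain ⟨m, hm, hmC⟩ := exists_pos_le_height hne hBL hdisc
  have hcont : Continuous fun t : ℝ => t • w := by fun_prop
  set T : Set ℝ := {t | t • w ∈ C}
  have hTc : IsClosed T := hCc.preimage hcont
  have hTpos : ∀ t ∈ T, 0 < t := fun t ht =>
    pos_of_mul_pos_left (hm.trans_le (hmC _ ht)) hw2.le
  have hTne : T.Nonempty := by
    obtain ⟨z, hz⟩ := hne
    obtain ⟨t, ht⟩ := exists_smul_sub_mem_futureCone hwc z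
    have := add_mem_closure_convexHull hBL hdisc hdense
      (subset_closure (subset_convexHull ℝ B hz)) ht
    exact ⟨t, by simpa [T, hC] using this⟩
  have hTb : BddBelow T := ⟨0, fun t ht => (hTpos t ht).le⟩
  have ht₀ : sInf T ∈ T := hTc.csInf_mem hTne hTb
  rw [hCc.frontier_eq]
  refine ⟨sInf T • w, ⟨⟨_, hTpos _ ht₀, rfl⟩, ht₀, fun hint => ?_⟩, ?_⟩
  · have hev : ∀ᶠ t in nhds (sInf T), t • w ∈ interior C :=
      hcont.continuousAt.eventually_mem (isOpen_interior.mem_nhds hint)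
    obtain ⟨t, ht, htlt⟩ := ((hev.filter_mono nhdsWithin_le_nhds).and
      (self_mem_nhdsWithin : Set.Iio (sInf T) ∈ nhdsWithin (sInf T) (Set.Iio (sInf T)))).exists
    exact (csInf_le hTb (interior_subset ht : t • w ∈ C)).not_gt htlt
  · rintro _ ⟨⟨t, -, rfl⟩, htC, htint⟩
    rcases (csInf_le hTb (htC : t ∈ T)).eq_or_lt with h | h
    · rw [h]
    · refine absurd ?_ htint
      have := add_mem_interior_closure_convexHull hBL hdisc hdense ht₀
        (smul_mem_futureCone hwc (sub_pos.2 h))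
      rwa [← add_smul, add_sub_cancel] at this

end
end

section
/- Let u₁, u₂, u₃ ∈ L⁺ be linearly independent, set λᵢⱼ = λ(uᵢ, uⱼ), and let v ∈ ℝ³ be the unique vector with ⟨uᵢ, v⟩ = −1 for i = 1, 2, 3 (v exists and is unique since the bilinear form is nondegenerate and u₁, u₂, u₃ form a basis), so that {w : ⟨w,v⟩ = −1} is the affine plane through u₁, u₂, u₃. Then ⟨v,v⟩ < 0 (the plane is elliptic) if and only if all three strict triangle inequalities λ₁₂ < λ₁₃ + λ₂₃, λ₁₃ < λ₁₂ + λ₂₃, λ₂₃ < λ₁₂ + λ₁₃ hold, and ⟨v,v⟩ = 0 (the plane is parabolic) if and only if one of the corresponding triangle equalities holds. -/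
noncomputable section

/-- The lambda length `λ(u,v) = √(−⟨u,v⟩)`. -/
def lam (u v : Fin 3 → ℝ) : ℝ := Real.sqrt (-(mink u v))

theorem sq_add_sq_eq_neg_two_mul_mink {u v : Fin 3 → ℝ} (hu : mink u u = 0) (hv : mink v v = 0) :
    (v 2 * u 0 - u 2 * v 0) ^ 2 + (v 2 * u 1 - u 2 * v 1) ^ 2 = -2 * (u 2 * v 2) * mink u v := by
  simp only [mink] at *
  linear_combination (v 2) ^ 2 * hu + (u 2) ^ 2 * hv

/-- Two linearly independent vectors of the positive light cone have negative product. -/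
theorem mink_neg_of_linearIndependent {u v : Fin 3 → ℝ} (hu : u ∈ LPlus) (hv : v ∈ LPlus)
    (h : LinearIndependent ℝ ![u, v]) : mink u v < 0 := by
  obtain ⟨hu0, hu2⟩ := hu
  obtain ⟨hv0, hv2⟩ := hv
  have key := sq_add_sq_eq_neg_two_mul_mink hu0 hv0
  have hpos : 0 < u 2 * v 2 := mul_pos hu2 hv2
  by_contra! hle
  have hprod : 0 ≤ u 2 * v 2 * mink u v := mul_nonneg hpos.le hle
  have e0 : v 2 * u 0 - u 2 * v 0 = 0 := by
    nlinarith [sq_nonneg (v 2 * u 0 - u 2 * v 0), sq_nonneg (v 2 * u 1 - u 2 * v 1)]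
  have e1 : v 2 * u 1 - u 2 * v 1 = 0 := by
    nlinarith [sq_nonneg (v 2 * u 0 - u 2 * v 0), sq_nonneg (v 2 * u 1 - u 2 * v 1)]
  have hz : v 2 • u + (-u 2) • v = 0 := by
    ext i
    fin_cases i
    · simpa [sub_eq_add_neg] using e0
    · simpa [sub_eq_add_neg] using e1
    · simp [mul_comm]
  exact hv2.ne' (LinearIndependent.pair_iff.mp h _ _ hz).1

theorem exists_eq_add_of_linearIndependent {u1 u2 u3 : Fin 3 → ℝ}
    (hind : LinearIndependent ℝ ![u1, u2, u3]) (v : Fin 3 → ℝ) :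
    ∃ x y z : ℝ, v = x • u1 + y • u2 + z • u3 := by
  have hspan := hind.span_eq_top_of_card_eq_finrank (by simp)
  have hv : v ∈ Submodule.span ℝ (Set.range ![u1, u2, u3]) := hspan ▸ Submodule.mem_top
  obtain ⟨c, hc⟩ := (Submodule.mem_span_range_iff_exists_fun ℝ).mp hv
  exact ⟨c 0, c 1, c 2, by simpa [Fin.sum_univ_three] using hc.symm⟩

/-- The plane through three light-like vectors has a normal `v` whose square is determined
by the pairwise products of the three vectors. -/
theorem two_mul_mink_self_eq {u1 u2 u3 v : Fin 3 → ℝ}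
    (h1 : mink u1 u1 = 0) (h2 : mink u2 u2 = 0) (h3 : mink u3 u3 = 0)
    (hind : LinearIndependent ℝ ![u1, u2, u3])
    (hv1 : mink u1 v = -1) (hv2 : mink u2 v = -1) (hv3 : mink u3 v = -1) :
    2 * (mink u1 u2 * mink u1 u3 * mink u2 u3) * mink v v =
      2 * (mink u1 u2 * mink u1 u3 + mink u1 u2 * mink u2 u3 + mink u1 u3 * mink u2 u3) -
        (mink u1 u2 ^ 2 + mink u1 u3 ^ 2 + mink u2 u3 ^ 2) := by
  obtain ⟨x, y, z, rfl⟩ := exists_eq_add_of_linearIndependent hind v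
  have e1 : y * mink u1 u2 + z * mink u1 u3 = -1 := by
    rw [← hv1]; simp only [mink, Pi.add_apply, Pi.smul_apply, smul_eq_mul] at *
    linear_combination -x * h1
  have e2 : x * mink u1 u2 + z * mink u2 u3 = -1 := by
    rw [← hv2]; simp only [mink, Pi.add_apply, Pi.smul_apply, smul_eq_mul] at *
    linear_combination -y * h2
  have e3 : x * mink u1 u3 + y * mink u2 u3 = -1 := by
    rw [← hv3]; simp only [mink, Pi.add_apply, Pi.smul_apply, smul_eq_mul] at *
    linear_combination -z * h3
  have e4 : mink (x • u1 + y • u2 + z • u3) (x • u1 + y • u2 + z • u3) = -(x + y + z) := by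
    simp only [mink, Pi.add_apply, Pi.smul_apply, smul_eq_mul] at *
    linear_combination x * hv1 + y * hv2 + z * hv3
  rw [e4]
  generalize mink u1 u2 = a at *
  generalize mink u1 u3 = b at *
  generalize mink u2 u3 = d at *
  linear_combination (d ^ 2 - b * d - a * d) * e1 + (b ^ 2 - b * d - a * b) * e2 +
    (a ^ 2 - a * d - a * b) * e3

/-- Heron's product detects the strict and the degenerate triangle inequalities. -/
theorem triangle_inequalities_iff_of_heron {p q r t c : ℝ} (hp : 0 < p) (hq : 0 < q) (hr : 0 < r)
    (hc : 0 < c) (h : c * t = -((p + q + r) * ((q + r - p) * (p + r - q) * (p + q - r)))) :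
    (t < 0 ↔ p < q + r ∧ q < p + r ∧ r < p + q) ∧
      (t = 0 ↔ p = q + r ∨ q = p + r ∨ r = p + q) := by
  have hs : 0 < p + q + r := by positivity
  refine ⟨⟨fun ht => ?_, fun ⟨h1, h2, h3⟩ => ?_⟩, fun ht => ?_, ?_⟩
  · have hpos : 0 < (q + r - p) * (p + r - q) * (p + q - r) := by
      have := mul_neg_of_pos_of_neg hc ht
      exact pos_of_mul_pos_right (by linarith) hs.le
    rcases lt_or_ge p (q + r) with h1 | h1 <;> rcases lt_or_ge q (p + r) with h2 | h2 <;>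
      rcases lt_or_ge r (p + q) with h3 | h3 <;> first | exact ⟨h1, h2, h3⟩ | exfalso
    · nlinarith [mul_pos (sub_pos.2 h1) (sub_pos.2 h2)]
    · nlinarith [mul_pos (sub_pos.2 h1) (sub_pos.2 h3)]
    · linarith
    · nlinarith [mul_pos (sub_pos.2 h2) (sub_pos.2 h3)]
    all_goals linarith
  · have hpos := mul_pos hs
      (mul_pos (mul_pos (sub_pos.2 h1) (sub_pos.2 h2)) (sub_pos.2 h3))
    exact neg_of_mul_neg_right (by linarith) hc.le
  · have h0 : (q + r - p) * (p + r - q) * (p + q - r) = 0 := by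
      have : (p + q + r) * ((q + r - p) * (p + r - q) * (p + q - r)) = 0 := by
        rw [ht] at h; linarith
      exact (mul_eq_zero.mp this).resolve_left hs.ne'
    rcases mul_eq_zero.mp h0 with h0 | h0
    · rcases mul_eq_zero.mp h0 with h0 | h0
      · left; linarith
      · right; left; linarith
    · right; right; linarith
  · intro h0
    have : c * t = 0 := by
      rw [h]; rcases h0 with h0 | h0 | h0 <;> rw [h0] <;> ring
    exact (mul_eq_zero.mp this).resolve_left (ne_of_gt hc)

/-- For linearly independent `u₁, u₂, u₃ ∈ L⁺`, let `v` be the (unique) vector with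
`⟨uᵢ, v⟩ = −1` for `i = 1,2,3`, so `{w : ⟨w,v⟩ = −1}` is the affine plane through
`u₁, u₂, u₃`.  This plane is elliptic (`⟨v,v⟩ < 0`) iff all three strict triangle
inequalities hold among the lambda lengths, and parabolic (`⟨v,v⟩ = 0`) iff one of the
corresponding triangle equalities holds. -/
theorem plane_elliptic_iff_triangle_inequalities (u1 u2 u3 : Fin 3 → ℝ)
    (h1 : u1 ∈ LPlus) (h2 : u2 ∈ LPlus) (h3 : u3 ∈ LPlus)
    (hind : LinearIndependent ℝ ![u1, u2, u3])
    (v : Fin 3 → ℝ) (hv1 : mink u1 v = -1) (hv2 : mink u2 v = -1) (hv3 : mink u3 v = -1) :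
    (mink v v < 0 ↔
      (lam u1 u2 < lam u1 u3 + lam u2 u3 ∧ lam u1 u3 < lam u1 u2 + lam u2 u3 ∧
        lam u2 u3 < lam u1 u2 + lam u1 u3)) ∧
    (mink v v = 0 ↔
      (lam u1 u2 = lam u1 u3 + lam u2 u3 ∨ lam u1 u3 = lam u1 u2 + lam u2 u3 ∨
        lam u2 u3 = lam u1 u2 + lam u1 u3)) := by
  have m12 : mink u1 u2 < 0 := by
    refine mink_neg_of_linearIndependent h1 h2 ?_
    convert hind.comp ![0, 1] (by decide) using 1
    ext i; fin_cases i <;> rfl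
  have m13 : mink u1 u3 < 0 := by
    refine mink_neg_of_linearIndependent h1 h3 ?_
    convert hind.comp ![0, 2] (by decide) using 1
    ext i; fin_cases i <;> rfl
  have m23 : mink u2 u3 < 0 := by
    refine mink_neg_of_linearIndependent h2 h3 ?_
    convert hind.comp ![1, 2] (by decide) using 1
    ext i; fin_cases i <;> rfl
  have key := two_mul_mink_self_eq h1.1 h2.1 h3.1 hind hv1 hv2 hv3
  have l12 : 0 < lam u1 u2 := Real.sqrt_pos.2 (neg_pos.2 m12)
  have l13 : 0 < lam u1 u3 := Real.sqrt_pos.2 (neg_pos.2 m13)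
  have l23 : 0 < lam u2 u3 := Real.sqrt_pos.2 (neg_pos.2 m23)
  have s12 : mink u1 u2 = -lam u1 u2 ^ 2 := by
    rw [lam, Real.sq_sqrt (neg_pos.2 m12).le, neg_neg]
  have s13 : mink u1 u3 = -lam u1 u3 ^ 2 := by
    rw [lam, Real.sq_sqrt (neg_pos.2 m13).le, neg_neg]
  have s23 : mink u2 u3 = -lam u2 u3 ^ 2 := by
    rw [lam, Real.sq_sqrt (neg_pos.2 m23).le, neg_neg]
  rw [s12, s13, s23] at key
  exact triangle_inequalities_iff_of_heron l12 l13 l23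
    (c := 2 * (lam u1 u2 ^ 2 * lam u1 u3 ^ 2 * lam u2 u3 ^ 2)) (by positivity)
    (by linear_combination -key)

end
end

section
/- Let D be a triangulation of the convex n-gon and let e, f ∈ D be diagonals with no common endpoint. Then f is a diagonal of flip_e(D), e is a diagonal of flip_f(D), and the flips commute: flip_f(flip_e(D)) = flip_e(flip_f(D)). (This is the commutativity relation for Whitehead moves along edges sharing no ideal endpoint.) -/
/-- Two vertices of the convex `n`-gon (labelled by `Fin n` in cyclic order) are cyclically
adjacent. -/
def AdjacentVert (n : ℕ) (a b : Fin n) : Prop :=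
  (b : ℕ) = ((a : ℕ) + 1) % n ∨ (a : ℕ) = ((b : ℕ) + 1) % n

/-- `x` lies strictly between `a` and `b` in the cyclic order on `Fin n` (i.e. in the open
arc from `a` to `b` in the positive cyclic direction). -/
def CyclicBetween {n : ℕ} (a x b : Fin n) : Prop :=
  (a < x ∧ x < b) ∨ (x < b ∧ b < a) ∨ (b < a ∧ a < x)

/-- A diagonal of the convex `n`-gon: an unordered pair of distinct, non-adjacent vertices. -/
def IsDiagonal (n : ℕ) (e : Sym2 (Fin n)) : Prop :=
  ∃ a b : Fin n, e = s(a, b) ∧ a ≠ b ∧ ¬ AdjacentVert n a b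

/-- Two diagonals `{a,b}` and `{c,d}` cross: exactly one of `c`, `d` lies strictly between
`a` and `b` in the cyclic order (equivalently, `c` lies strictly between `a` and `b`, and
`d` lies strictly between `b` and `a`). -/
def Crosses {n : ℕ} (e f : Sym2 (Fin n)) : Prop :=
  ∃ a b c d : Fin n, e = s(a, b) ∧ f = s(c, d) ∧ CyclicBetween a c b ∧ CyclicBetween b d a

/-- `D` is a set of pairwise non-crossing diagonals of the `n`-gon. -/
def NonCrossingDiagonals (n : ℕ) (D : Set (Sym2 (Fin n))) : Prop :=
  (∀ e ∈ D, IsDiagonal n e) ∧ ∀ e ∈ D, ∀ f ∈ D, ¬ Crosses e f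

/-- A triangulation of the convex `n`-gon: a maximal set of pairwise non-crossing
diagonals. -/
def IsTriangulation (n : ℕ) (D : Set (Sym2 (Fin n))) : Prop :=
  NonCrossingDiagonals n D ∧
    ∀ e, IsDiagonal n e → e ∉ D → ¬ NonCrossingDiagonals n (insert e D)

open Classical in
/-- The flip (Whitehead move) of a triangulation `D` along `e ∈ D`: replace `e` by the
unique other diagonal `e'` such that `(D \ {e}) ∪ {e'}` is again a triangulation. -/
noncomputable def flipDiag (n : ℕ) (D : Set (Sym2 (Fin n))) (e : Sym2 (Fin n)) :
    Set (Sym2 (Fin n)) :=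
  if h : ∃ e', e' ≠ e ∧ IsTriangulation n ((D \ {e}) ∪ {e'}) then
    (D \ {e}) ∪ {h.choose}
  else D

theorem Fin.val_add_one_mod {n : ℕ} (x : Fin n) :
    ((x : ℕ) + 1) % n = if (x : ℕ) + 1 = n then 0 else (x : ℕ) + 1 := by
  split_ifs with h
  · simp [h]
  · exact Nat.mod_eq_of_lt (by omega)

theorem CyclicBetween.not_adjacentVert {n : ℕ} {a b c d : Fin n} (hc : CyclicBetween a c b)
    (hd : CyclicBetween b d a) : ¬ AdjacentVert n a b := by
  simp only [AdjacentVert, CyclicBetween, Fin.lt_def, Fin.val_add_one_mod] at *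
  split_ifs <;> omega

theorem exists_cyclicBetween_adjacentVert {n : ℕ} {a b : Fin n} (hab : a ≠ b)
    (h : ¬ AdjacentVert n a b) : ∃ c, CyclicBetween a c b ∧ AdjacentVert n a c := by
  have hlt : ((a : ℕ) + 1) % n < n := Nat.mod_lt _ (by omega)
  refine ⟨⟨((a : ℕ) + 1) % n, hlt⟩, ?_, Or.inl rfl⟩
  have hb := b.isLt
  have hne : (a : ℕ) ≠ b := fun h => hab (Fin.ext h)
  have hb' : (b : ℕ) ≠ ((a : ℕ) + 1) % n := fun h' => h (Or.inl h')
  simp only [CyclicBetween, Fin.lt_def, Fin.val_add_one_mod] at *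
  split_ifs at * <;> omega

theorem AdjacentVert.symm {n : ℕ} {a b : Fin n} (h : AdjacentVert n a b) : AdjacentVert n b a :=
  Or.symm h

theorem CyclicBetween.ne {n : ℕ} {a b c : Fin n} (h : CyclicBetween a c b) :
    a ≠ b ∧ c ≠ a ∧ c ≠ b := by
  refine ⟨?_, ?_, ?_⟩ <;> rintro rfl <;> simp only [CyclicBetween, Fin.lt_def] at h <;> omega

theorem crosses_mk_iff {n : ℕ} {a b c d : Fin n} :
    Crosses s(a, b) s(c, d) ↔ (CyclicBetween a c b ∧ CyclicBetween b d a) ∨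
      (CyclicBetween a d b ∧ CyclicBetween b c a) := by
  constructor
  · rintro ⟨a', b', c', d', h₁, h₂, h₃, h₄⟩
    rcases Sym2.eq_iff.1 h₁ with ⟨rfl, rfl⟩ | ⟨rfl, rfl⟩ <;>
      rcases Sym2.eq_iff.1 h₂ with ⟨rfl, rfl⟩ | ⟨rfl, rfl⟩ <;> tauto
  · rintro (⟨h₁, h₂⟩ | ⟨h₁, h₂⟩)
    · exact ⟨a, b, c, d, rfl, rfl, h₁, h₂⟩
    · exact ⟨a, b, d, c, rfl, Sym2.eq_swap, h₁, h₂⟩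

theorem CyclicBetween.rotate {n : ℕ} {a b c d : Fin n} (hc : CyclicBetween a c b)
    (hd : CyclicBetween b d a) : CyclicBetween c b d ∧ CyclicBetween d a c := by
  simp only [CyclicBetween, Fin.lt_def] at *
  omega

theorem Crosses.symm {n : ℕ} {e f : Sym2 (Fin n)} (h : Crosses e f) : Crosses f e := by
  obtain ⟨a, b, c, d, rfl, rfl, hc, hd⟩ := h
  exact crosses_mk_iff.2 (Or.inr (hc.rotate hd))

theorem not_crosses_self {n : ℕ} (e : Sym2 (Fin n)) : ¬ Crosses e e := by
  induction e with
  | _ a b =>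
    rw [crosses_mk_iff]
    rintro (⟨h, -⟩ | ⟨h, -⟩)
    · exact h.ne.2.1 rfl
    · exact h.ne.2.2 rfl

/-- Crossing pairs of vertices are diagonals. -/
theorem Crosses.isDiagonal {n : ℕ} {e f : Sym2 (Fin n)} (h : Crosses e f) : IsDiagonal n e := by
  obtain ⟨a, b, c, d, rfl, rfl, hc, hd⟩ := h
  exact ⟨a, b, rfl, hc.ne.1, hc.not_adjacentVert hd⟩

/-- `{a, b}` is a side of the polygon or belongs to `S`. -/
def IsSide {n : ℕ} (S : Set (Sym2 (Fin n))) (a b : Fin n) : Prop :=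
  AdjacentVert n a b ∨ s(a, b) ∈ S

theorem IsSide.not_separates {n : ℕ} {S : Set (Sym2 (Fin n))} {a b p q : Fin n}
    (h : IsSide S a b) (hS : ∀ y ∈ S, ¬ Crosses y s(p, q)) (hp : CyclicBetween a p b) :
    ¬ CyclicBetween b q a := fun hq =>
  h.elim (hp.not_adjacentVert hq) fun h => hS _ h (crosses_mk_iff.2 (Or.inl ⟨hp, hq⟩))

/-- `a, c, b, d` are, in cyclic order, the vertices of a quadrilateral whose sides are sides of
the polygon or belong to `S`. -/
structure IsQuadrilateral {n : ℕ} (S : Set (Sym2 (Fin n))) (a c b d : Fin n) : Prop where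
  left : CyclicBetween a c b
  right : CyclicBetween b d a
  side₁ : IsSide S a c
  side₂ : IsSide S c b
  side₃ : IsSide S b d
  side₄ : IsSide S d a

namespace IsQuadrilateral

variable {n : ℕ} {S : Set (Sym2 (Fin n))} {a b c d : Fin n}

theorem rotate (h : IsQuadrilateral S a c b d) : IsQuadrilateral S c b d a where
  left := (h.left.rotate h.right).1
  right := (h.left.rotate h.right).2
  side₁ := h.side₂
  side₂ := h.side₃
  side₃ := h.side₄
  side₄ := h.side₁

theorem crosses (h : IsQuadrilateral S a c b d) : Crosses s(a, b) s(c, d) :=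
  ⟨a, b, c, d, rfl, rfl, h.left, h.right⟩

theorem eq_of_cyclicBetween (h : IsQuadrilateral S a c b d) {p q : Fin n}
    (hS : ∀ y ∈ S, ¬ Crosses y s(p, q)) (hp : CyclicBetween a p b) (hq : CyclicBetween b q a) :
    p = c := by
  by_contra hne
  have hne' : (p : ℕ) ≠ c := fun h => hne (Fin.ext h)
  have h₁ := h.left
  have key : (CyclicBetween a p c ∧ CyclicBetween c q a) ∨
      (CyclicBetween c p b ∧ CyclicBetween b q c) := by
    simp only [CyclicBetween, Fin.lt_def] at *
    omega
  rcases key with ⟨hp', hq'⟩ | ⟨hp', hq'⟩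
  · exact h.side₁.not_separates hS hp' hq'
  · exact h.side₂.not_separates hS hp' hq'

/-- The only chord crossing one diagonal of the quadrilateral and crossing no element of `S` is
the other diagonal. -/
theorem eq_of_crosses (h : IsQuadrilateral S a c b d) {x : Sym2 (Fin n)}
    (hS : ∀ y ∈ S, ¬ Crosses y x) (hx : Crosses s(a, b) x) : x = s(c, d) := by
  have key : ∀ {p q : Fin n}, (∀ y ∈ S, ¬ Crosses y s(p, q)) → CyclicBetween a p b →
      CyclicBetween b q a → s(p, q) = s(c, d) := by
    intro p q hS hp hq
    rw [h.eq_of_cyclicBetween hS hp hq,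
      h.rotate.rotate.eq_of_cyclicBetween (Sym2.eq_swap (a := p) ▸ hS) hq hp]
  induction x with
  | _ p q =>
    rcases crosses_mk_iff.1 hx with ⟨hp, hq⟩ | ⟨hq, hp⟩
    · exact key hS hp hq
    · rw [Sym2.eq_swap]
      exact key (Sym2.eq_swap (a := p) ▸ hS) hq hp

theorem mono (h : IsQuadrilateral S a c b d) {T : Set (Sym2 (Fin n))}
    (hT : ∀ x ∈ S, (a ∈ x ∨ b ∈ x) → x ∈ T) : IsQuadrilateral T a c b d where
  left := h.left
  right := h.right
  side₁ := h.side₁.imp id fun hx => hT _ hx (by simp)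
  side₂ := h.side₂.imp id fun hx => hT _ hx (by simp)
  side₃ := h.side₃.imp id fun hx => hT _ hx (by simp)
  side₄ := h.side₄.imp id fun hx => hT _ hx (by simp)

end IsQuadrilateral

namespace IsTriangulation

variable {n : ℕ} {D : Set (Sym2 (Fin n))}

theorem mem_of_not_crosses (hD : IsTriangulation n D) {x : Sym2 (Fin n)} (hx : IsDiagonal n x)
    (h : ∀ y ∈ D, ¬ Crosses y x) : x ∈ D := by
  by_contra hxD
  refine hD.2 x hx hxD ⟨?_, ?_⟩
  · rintro y (rfl | hy)
    exacts [hx, hD.1.1 y hy]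
  · rintro y (rfl | hy) z (rfl | hz)
    exacts [not_crosses_self _, fun hc => h z hz hc.symm, h y hy, hD.1.2 y hy z hz]

/-- In a triangulation, each of the two arcs cut off by a diagonal contains the third vertex of a
triangle on that diagonal. -/
theorem exists_triangle (hD : IsTriangulation n D) {a b : Fin n} (h : s(a, b) ∈ D) :
    ∃ c, CyclicBetween a c b ∧ IsSide D a c ∧ IsSide D c b := by
  classical
  have hab : a ≠ b ∧ ¬ AdjacentVert n a b := by
    obtain ⟨a', b', he, hne, hadj⟩ := hD.1.1 _ h
    rcases Sym2.eq_iff.1 he with ⟨rfl, rfl⟩ | ⟨rfl, rfl⟩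
    exacts [⟨hne, hadj⟩, ⟨hne.symm, fun h => hadj h.symm⟩]
  obtain ⟨c₀, hc₀, hadj⟩ := exists_cyclicBetween_adjacentVert hab.1 hab.2
  obtain ⟨c, hc, hmax⟩ := Finset.exists_max_image
    (Finset.univ.filter fun c => CyclicBetween a c b ∧ IsSide D a c)
    (fun c : Fin n => if a < c then (c : ℕ) else c + n)
    ⟨c₀, by simpa using ⟨hc₀, Or.inl hadj⟩⟩
  simp only [Finset.mem_filter, Finset.mem_univ, true_and] at hc hmax
  obtain ⟨hcb, hac⟩ := hc
  refine ⟨c, hcb, hac, ?_⟩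
  by_cases hcadj : AdjacentVert n c b
  · exact Or.inl hcadj
  refine Or.inr (hD.mem_of_not_crosses ⟨c, b, rfl, hcb.ne.2.2, hcadj⟩ fun x hx hcross => ?_)
  obtain ⟨c', b', p, q, he, rfl, hp, hq⟩ := hcross.symm
  have key : ∀ p q : Fin n, s(p, q) ∈ D → CyclicBetween c p b → CyclicBetween b q c → False := by
    intro p q hx hp hq
    have hpab : CyclicBetween a p b := by
      simp only [CyclicBetween, Fin.lt_def] at *
      omega
    have hqa : q = a := by
      by_contra hne
      have hne' : (q : ℕ) ≠ a := fun h => hne (Fin.ext h)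
      have hnot : ¬ CyclicBetween b q a := fun hqba =>
        hD.1.2 _ h _ hx (crosses_mk_iff.2 (Or.inl ⟨hpab, hqba⟩))
      have hqc : CyclicBetween a q c ∧ CyclicBetween c p a := by
        simp only [CyclicBetween, Fin.lt_def] at *
        omega
      exact hac.not_separates (fun y hy => hD.1.2 _ hy _ (Sym2.eq_swap (a := p) ▸ hx)) hqc.1 hqc.2
    subst hqa
    have hle := hmax p ⟨hpab, Or.inr (Sym2.eq_swap (a := p) ▸ hx)⟩
    have hpn := p.isLt
    have hcn := c.isLt
    simp only [CyclicBetween, Fin.lt_def] at *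
    split_ifs at hle <;> omega
  rcases Sym2.eq_iff.1 he with ⟨rfl, rfl⟩ | ⟨rfl, rfl⟩
  · exact key p q hx hp hq
  · exact key q p (Sym2.eq_swap (a := p) ▸ hx) hq hp

theorem exists_isQuadrilateral (hD : IsTriangulation n D) {a b : Fin n} (h : s(a, b) ∈ D) :
    ∃ c d, IsQuadrilateral (D \ {s(a, b)}) a c b d := by
  obtain ⟨c, hc, hac, hcb⟩ := hD.exists_triangle h
  obtain ⟨d, hd, hbd, hda⟩ := hD.exists_triangle (Sym2.eq_swap (a := a) ▸ h)
  have hcne := hc.ne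
  have hdne := hd.ne
  refine ⟨c, d, hc, hd, hac.imp id fun h => ⟨h, ?_⟩, hcb.imp id fun h => ⟨h, ?_⟩,
    hbd.imp id fun h => ⟨h, ?_⟩, hda.imp id fun h => ⟨h, ?_⟩⟩ <;>
  · simp only [Set.mem_singleton_iff, Sym2.eq_iff]
    tauto

theorem flip (hD : IsTriangulation n D) {a b c d : Fin n}
    (hq : IsQuadrilateral (D \ {s(a, b)}) a c b d) :
    IsTriangulation n ((D \ {s(a, b)}) ∪ {s(c, d)}) := by
  have hnc : ∀ y ∈ D \ {s(a, b)}, ¬ Crosses s(c, d) y := fun y hy hcross =>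
    hy.2 ((hq.rotate.eq_of_crosses (fun z hz => hD.1.2 z hz.1 y hy.1) hcross).trans Sym2.eq_swap)
  refine ⟨⟨?_, ?_⟩, fun x hx hxD hxnc => ?_⟩
  · rintro y (hy | rfl)
    exacts [hD.1.1 y hy.1, hq.crosses.symm.isDiagonal]
  · rintro y (hy | rfl) z (hz | rfl)
    exacts [hD.1.2 y hy.1 z hz.1, fun hc => hnc y hy hc.symm, hnc z hz, not_crosses_self _]
  · have hx' : ∀ y ∈ D \ {s(a, b)}, ¬ Crosses y x := fun y hy =>
      hxnc.2 y (Or.inr (Or.inl hy)) x (Or.inl rfl)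
    by_cases hcross : Crosses s(a, b) x
    · exact hxD (Or.inr (hq.eq_of_crosses hx' hcross))
    · have hmem : x ∈ D := hD.mem_of_not_crosses hx fun y hy => by
        by_cases hye : y = s(a, b)
        exacts [hye ▸ hcross, hx' y ⟨hy, hye⟩]
      by_cases hxe : x = s(a, b)
      · exact hxnc.2 x (Or.inl rfl) s(c, d) (Or.inr (Or.inr rfl)) (hxe ▸ hq.crosses)
      · exact hxD (Or.inl ⟨hmem, hxe⟩)

theorem flipDiag_eq (hD : IsTriangulation n D) {a b c d : Fin n} (h : s(a, b) ∈ D)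
    (hq : IsQuadrilateral (D \ {s(a, b)}) a c b d) :
    flipDiag n D s(a, b) = (D \ {s(a, b)}) ∪ {s(c, d)} := by
  have hex : ∃ e', e' ≠ s(a, b) ∧ IsTriangulation n ((D \ {s(a, b)}) ∪ {e'}) :=
    ⟨s(c, d), fun he => not_crosses_self s(a, b) (by simpa [he] using hq.crosses), hD.flip hq⟩
  have huniq : ∀ e', e' ≠ s(a, b) → IsTriangulation n ((D \ {s(a, b)}) ∪ {e'}) →
      e' = s(c, d) := by
    intro e' hne ht
    refine hq.eq_of_crosses (fun y hy => ht.1.2 y (Or.inl hy) e' (Or.inr rfl)) ?_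
    by_contra hnc
    have hmem : s(a, b) ∈ (D \ {s(a, b)}) ∪ {e'} :=
      ht.mem_of_not_crosses (hD.1.1 _ h) (by
        rintro y (hy | rfl)
        exacts [hD.1.2 y hy.1 _ h, fun hc => hnc hc.symm])
    rcases hmem with hmem | hmem
    exacts [hmem.2 rfl, hne hmem.symm]
  rw [flipDiag, dif_pos hex, huniq _ hex.choose_spec.1 hex.choose_spec.2]

/-- A second flip, along a diagonal sharing no endpoint with the first one, replaces that diagonal
by the one it would have been replaced by in `D`. -/
theorem flipDiag_flipDiag_eq (hD : IsTriangulation n D) {a b c d a' b' c' d' : Fin n}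
    (he : s(a, b) ∈ D) (hf : s(a', b') ∈ D)
    (hdisj : ∀ v : Fin n, v ∈ s(a, b) → v ∉ s(a', b'))
    (hq : IsQuadrilateral (D \ {s(a, b)}) a c b d)
    (hq' : IsQuadrilateral (D \ {s(a', b')}) a' c' b' d') :
    flipDiag n (flipDiag n D s(a, b)) s(a', b') =
      (((D \ {s(a, b)}) ∪ {s(c, d)}) \ {s(a', b')}) ∪ {s(c', d')} := by
  rw [hD.flipDiag_eq he hq]
  have hne : s(a', b') ≠ s(a, b) := fun h => hdisj a (by simp) (by simp [h])
  refine (hD.flip hq).flipDiag_eq (Or.inl ⟨hf, hne⟩) (hq'.mono fun x hx hv => ?_)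
  refine ⟨Or.inl ⟨hx.1, ?_⟩, hx.2⟩
  rintro rfl
  rcases hv with hv | hv
  exacts [hdisj _ hv (by simp), hdisj _ hv (by simp)]

end IsTriangulation

/-- If `e, f` are diagonals of a triangulation `D` of the convex `n`-gon with no common
endpoint, then `f` is a diagonal of `flip_e(D)`, `e` is a diagonal of `flip_f(D)`, and the
flips commute: `flip_f(flip_e(D)) = flip_e(flip_f(D))`. -/
theorem flips_commute (n : ℕ) (hn : 4 ≤ n) (D : Set (Sym2 (Fin n)))
    (hD : IsTriangulation n D) (e f : Sym2 (Fin n)) (he : e ∈ D) (hf : f ∈ D)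
    (hdisj : ∀ v : Fin n, v ∈ e → v ∉ f) :
    f ∈ flipDiag n D e ∧ e ∈ flipDiag n D f ∧
      flipDiag n (flipDiag n D e) f = flipDiag n (flipDiag n D f) e := by
  induction e with
  | _ a b =>
  induction f with
  | _ a' b' =>
  obtain ⟨c, d, hq⟩ := hD.exists_isQuadrilateral he
  obtain ⟨c', d', hq'⟩ := hD.exists_isQuadrilateral hf
  have hne : s(a', b') ≠ s(a, b) := fun h => hdisj a (by simp) (by simp [h])
  have hcd : s(c, d) ≠ s(a', b') := fun h => hD.1.2 _ he _ hf (h ▸ hq.crosses)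
  have hcd' : s(c', d') ≠ s(a, b) := fun h => hD.1.2 _ hf _ he (h ▸ hq'.crosses)
  refine ⟨?_, ?_, ?_⟩
  · rw [hD.flipDiag_eq he hq]
    exact Or.inl ⟨hf, hne⟩
  · rw [hD.flipDiag_eq hf hq']
    exact Or.inl ⟨he, hne.symm⟩
  · rw [hD.flipDiag_flipDiag_eq he hf hdisj hq hq',
      hD.flipDiag_flipDiag_eq hf he (fun v hv hv' => hdisj v hv' hv) hq' hq]
    ext x
    simp only [Set.mem_union, Set.mem_sdiff, Set.mem_singleton_iff]
    grind
end
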